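/- arXiv:2510.16930 — 2 statements merged into one kernel-verified Lean document; each statement's English description precedes it below -/
import Mathlib

section
/- Per-iteration gradient bound for HOQRI (tensor form). Let X be an N-way tensor, let {U_t}_{t≥0} be HOQRI iterates (with each updated TTMcTC matrix assumed to have full column rank), and let f_sup be any real number satisfying f({V}) ≤ f_sup for every tuple {V} of factor matrices with orthonormal columns. Then for every step t, with n = n_t the block updated at step t, ‖ 2 A_t^{(n)} − 2 U_t^{(n)} M_t^{(n)} ‖_F² ≤ 4 f_sup · ( f({U_{t+1}}) − f({U_t}) ), where A_t^{(n)} is the mode-n TTMcTC matrix at {U_t} and M_t^{(n)} = G_{(n),t} G_{(n),t}ᵀ is the Gram matrix of the mode-n unfolding of the core tensor at {U_t}. -/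
open Matrix Finset

noncomputable section

/-- Squared Frobenius norm of a real matrix: `‖M‖_F² = tr(Mᵀ M)`. -/
def frobSq {I K : ℕ} (M : Matrix (Fin I) (Fin K) ℝ) : ℝ := Matrix.trace (Mᵀ * M)

/-- The Tucker core tensor: `G(k) = ∑_i X(i) ∏_n U⁽ⁿ⁾(iₙ, kₙ)`. -/
def core {N : ℕ} {Idim Kdim : Fin N → ℕ} (X : (∀ n, Fin (Idim n)) → ℝ)
    (U : ∀ n, Matrix (Fin (Idim n)) (Fin (Kdim n)) ℝ) :
    (∀ n, Fin (Kdim n)) → ℝ :=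
  fun k => ∑ i : ∀ n, Fin (Idim n), X i * ∏ n, U n (i n) (k n)

/-- The Tucker objective `f({U}) = ∑_k G(k)²`, the squared norm of the core. -/
def obj {N : ℕ} {Idim Kdim : Fin N → ℕ} (X : (∀ n, Fin (Idim n)) → ℝ)
    (U : ∀ n, Matrix (Fin (Idim n)) (Fin (Kdim n)) ℝ) : ℝ :=
  ∑ k : ∀ n, Fin (Kdim n), (core X U k) ^ 2

/-- The mode-`n` TTMcTC matrix `A⁽ⁿ⁾`, with entries
`A⁽ⁿ⁾(a,b) = ∑_{i : iₙ = a} ∑_{k : kₙ = b} X(i) G(k) ∏_{ν ≠ n} U⁽ᵛ⁾(i_ν, k_ν)`. -/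
def ttmctc {N : ℕ} {Idim Kdim : Fin N → ℕ} (X : (∀ n, Fin (Idim n)) → ℝ)
    (n : Fin N) (U : ∀ m, Matrix (Fin (Idim m)) (Fin (Kdim m)) ℝ) :
    Matrix (Fin (Idim n)) (Fin (Kdim n)) ℝ :=
  Matrix.of fun a b =>
    ∑ i : ∀ ν, Fin (Idim ν), ∑ k : ∀ ν, Fin (Kdim ν),
      if i n = a ∧ k n = b then
        X i * core X U k * ∏ ν ∈ Finset.univ.erase n, U ν (i ν) (k ν)
      else 0

/-- The mode-`n` Gram matrix of the core, `M⁽ⁿ⁾ = G₍ₙ₎ G₍ₙ₎ᵀ`, with entries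
`M⁽ⁿ⁾(a,b) = ∑_{k_ν, ν≠n} G(…,a,…) G(…,b,…)`. -/
def gramCore {N : ℕ} {Idim Kdim : Fin N → ℕ} (X : (∀ n, Fin (Idim n)) → ℝ)
    (n : Fin N) (U : ∀ m, Matrix (Fin (Idim m)) (Fin (Kdim m)) ℝ) :
    Matrix (Fin (Kdim n)) (Fin (Kdim n)) ℝ :=
  Matrix.of fun a b =>
    ∑ k : ∀ ν, Fin (Kdim ν),
      if k n = a then core X U k * core X U (Function.update k n b) else 0

/-- The block updated at step `t` of HOQRI: `n_t = (t mod N) + 1` (here 0-indexed as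
`t mod N`). -/
def blockAt {N : ℕ} (hN : 0 < N) (t : ℕ) : Fin N := ⟨t % N, Nat.mod_lt t hN⟩

/-- `U : ℕ → …` is a sequence of HOQRI iterates: the initial factors have orthonormal
columns, and at each step `t` the block `n_t = (t mod N) + 1` is replaced by a matrix
with orthonormal columns whose column space equals the column space of the TTMcTC
matrix `A⁽ⁿᵗ⁾` computed at `{U_t}` (assumed to have full column rank), while all
other blocks are unchanged. -/
def IsHOQRI {N : ℕ} (hN : 0 < N) {Idim Kdim : Fin N → ℕ}
    (X : (∀ n, Fin (Idim n)) → ℝ)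
    (U : ℕ → ∀ n, Matrix (Fin (Idim n)) (Fin (Kdim n)) ℝ) : Prop :=
  (∀ n, (U 0 n)ᵀ * U 0 n = 1) ∧
  ∀ t : ℕ,
    ((U (t + 1) (blockAt hN t))ᵀ * U (t + 1) (blockAt hN t) = 1) ∧
    Function.Injective (ttmctc X (blockAt hN t) (U t)).mulVecLin ∧
    LinearMap.range (U (t + 1) (blockAt hN t)).mulVecLin =
      LinearMap.range (ttmctc X (blockAt hN t) (U t)).mulVecLin ∧
    ∀ m : Fin N, m ≠ blockAt hN t → U (t + 1) m = U t m

theorem Matrix.trace_transpose_mul_self_eq_sum_sq {ι κ : Type*} [Fintype ι] [Fintype κ]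
    (M : Matrix ι κ ℝ) : (Mᵀ * M).trace = ∑ i, ∑ j, M i j ^ 2 := by
  simp only [trace, diag_apply, mul_apply, transpose_apply, ← pow_two]
  exact Finset.sum_comm

/-- Submultiplicativity of the squared Frobenius norm. -/
theorem Matrix.trace_transpose_mul_self_mul_transpose_le {ι κ μ : Type*}
    [Fintype ι] [Fintype κ] [Fintype μ] (D : Matrix ι κ ℝ) (G : Matrix μ κ ℝ) :
    ((D * Gᵀ)ᵀ * (D * Gᵀ)).trace ≤ (Gᵀ * G).trace * (Dᵀ * D).trace := by
  simp only [trace_transpose_mul_self_eq_sum_sq]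
  rw [mul_comm, Finset.sum_mul_sum]
  refine Finset.sum_le_sum fun i _ => Finset.sum_le_sum fun b _ => ?_
  simp only [mul_apply, transpose_apply]
  exact Finset.sum_mul_sq_le_sq_mul_sq _ _ _

theorem Matrix.exists_eq_mul_of_range_mulVecLin_le {ι κ μ : Type*} [Fintype κ] [Fintype μ]
    [DecidableEq μ] {V : Matrix ι κ ℝ} {A : Matrix ι μ ℝ}
    (h : LinearMap.range A.mulVecLin ≤ LinearMap.range V.mulVecLin) :
    ∃ C : Matrix κ μ ℝ, A = V * C := by
  have hcol : ∀ b, ∃ c : κ → ℝ, V *ᵥ c = A *ᵥ Pi.single b 1 := fun b =>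
    h ⟨Pi.single b 1, rfl⟩
  choose c hc using hcol
  refine ⟨of fun a b => c b a, ?_⟩
  ext a b
  have := congrFun (hc b) a
  rw [mulVec_single_one] at this
  exact this.symm

/-- If `U` and `V` have orthonormal columns and the columns of `Y (Uᵀ Y)ᵀ` lie in the range
of `V`, then the Riemannian gradient of `‖Uᵀ Y‖²` at `U` is controlled by the increase of the
objective from `U` to `V`. -/
theorem Matrix.trace_gradient_le_mul_sub {ι κ μ : Type*} [Fintype ι] [Fintype κ] [Fintype μ]
    [DecidableEq κ] (Y : Matrix ι μ ℝ) (U V : Matrix ι κ ℝ)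
    (hU : Uᵀ * U = 1) (hV : Vᵀ * V = 1)
    (hrange : LinearMap.range (Y * (Uᵀ * Y)ᵀ).mulVecLin ≤ LinearMap.range V.mulVecLin)
    {c : ℝ} (hc : ((Uᵀ * Y)ᵀ * (Uᵀ * Y)).trace ≤ c) :
    ((Y * (Uᵀ * Y)ᵀ - U * ((Uᵀ * Y) * (Uᵀ * Y)ᵀ))ᵀ *
      (Y * (Uᵀ * Y)ᵀ - U * ((Uᵀ * Y) * (Uᵀ * Y)ᵀ))).trace ≤
      c * (((Vᵀ * Y)ᵀ * (Vᵀ * Y)).trace - ((Uᵀ * Y)ᵀ * (Uᵀ * Y)).trace) := by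
  obtain ⟨C, hC⟩ := exists_eq_mul_of_range_mulVecLin_le hrange
  set G := Uᵀ * Y with hG
  set Z := Vᵀ * Y with hZ
  have hA : V * (Z * Gᵀ) = Y * Gᵀ := by
    rw [hZ, Matrix.mul_assoc Vᵀ, hC, ← Matrix.mul_assoc Vᵀ, hV, Matrix.one_mul]
  have hfactor : Y * Gᵀ - U * (G * Gᵀ) = (V * Z - U * G) * Gᵀ := by
    rw [Matrix.sub_mul, Matrix.mul_assoc V, hA, Matrix.mul_assoc U]
  have hcross : ((U * G)ᵀ * (V * Z)).trace = (Gᵀ * G).trace := by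
    calc ((U * G)ᵀ * (V * Z)).trace = (Uᵀ * (V * (Z * Gᵀ))).trace := by
          rw [transpose_mul, Matrix.mul_assoc, trace_mul_comm]
          simp only [Matrix.mul_assoc]
      _ = (Gᵀ * G).trace := by
          rw [hA, ← Matrix.mul_assoc, ← hG, trace_mul_comm]
  have hcross' : ((V * Z)ᵀ * (U * G)).trace = (Gᵀ * G).trace := by
    rw [← hcross, ← trace_transpose, transpose_mul, transpose_transpose]
  have hself : ∀ {W : Matrix ι κ ℝ} (H : Matrix κ μ ℝ), Wᵀ * W = 1 →
      ((W * H)ᵀ * (W * H)).trace = (Hᵀ * H).trace := fun {W} H hW => by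
    rw [transpose_mul, Matrix.mul_assoc, ← Matrix.mul_assoc Wᵀ, hW, Matrix.one_mul]
  have hdist : ((V * Z - U * G)ᵀ * (V * Z - U * G)).trace =
      (Zᵀ * Z).trace - (Gᵀ * G).trace := by
    rw [transpose_sub, Matrix.sub_mul, Matrix.mul_sub, Matrix.mul_sub]
    simp only [trace_sub]
    rw [hcross, hcross', hself Z hV, hself G hU]
    ring
  rw [hfactor, ← hdist]
  refine (trace_transpose_mul_self_mul_transpose_le _ G).trans
    (mul_le_mul_of_nonneg_right hc ?_)
  rw [trace_transpose_mul_self_eq_sum_sq]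
  positivity

section Unfolding

variable {N : ℕ} {Idim Kdim : Fin N → ℕ}

/-- The mode-`n` unfolding of `X` contracted with all factor matrices except the `n`-th. -/
def partialUnfolding (X : (∀ n, Fin (Idim n)) → ℝ) (n : Fin N)
    (U : ∀ m, Matrix (Fin (Idim m)) (Fin (Kdim m)) ℝ) :
    Matrix (Fin (Idim n)) (∀ ν : {ν // ν ≠ n}, Fin (Kdim ν)) ℝ :=
  of fun a j => ∑ i : ∀ ν, Fin (Idim ν),
    if i n = a then X i * ∏ ν : {ν // ν ≠ n}, U ν (i ν) (j ν) else 0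

theorem partialUnfolding_congr (X : (∀ n, Fin (Idim n)) → ℝ) (n : Fin N)
    {U V : ∀ m, Matrix (Fin (Idim m)) (Fin (Kdim m)) ℝ} (h : ∀ m, m ≠ n → V m = U m) :
    partialUnfolding X n V = partialUnfolding X n U := by
  ext a j
  have hν : ∀ ν : {ν // ν ≠ n}, V ν = U ν := fun ν => h ν ν.2
  simp only [partialUnfolding, of_apply, hν]

theorem prod_erase_eq_prod_subtype_ne (n : Fin N) (f : Fin N → ℝ) :
    ∏ ν ∈ Finset.univ.erase n, f ν = ∏ ν : {ν // ν ≠ n}, f ν :=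
  Finset.prod_subtype _ (by simp) f

theorem core_eq_transpose_mul_partialUnfolding (X : (∀ n, Fin (Idim n)) → ℝ) (n : Fin N)
    (U : ∀ m, Matrix (Fin (Idim m)) (Fin (Kdim m)) ℝ) (k : ∀ ν, Fin (Kdim ν)) :
    core X U k = ((U n)ᵀ * partialUnfolding X n U) (k n) fun ν => k ν := by
  simp only [core, partialUnfolding, mul_apply, transpose_apply, of_apply, Finset.mul_sum]
  rw [Finset.sum_comm]
  refine Finset.sum_congr rfl fun i _ => ?_
  rw [← Finset.mul_prod_erase _ _ (Finset.mem_univ n), prod_erase_eq_prod_subtype_ne]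
  simp
  ring

theorem sum_pi_eq_sum_sum_piSplitAt (n : Fin N) (f : (∀ ν, Fin (Kdim ν)) → ℝ) :
    ∑ k, f k = ∑ b, ∑ j, f ((Equiv.piSplitAt n fun ν => Fin (Kdim ν)).symm (b, j)) := by
  rw [← Fintype.sum_prod_type']
  exact ((Equiv.piSplitAt n fun ν => Fin (Kdim ν)).symm.sum_comp f).symm

theorem piSplitAt_symm_self (n : Fin N) (b : Fin (Kdim n))
    (j : ∀ ν : {ν // ν ≠ n}, Fin (Kdim ν)) :
    (Equiv.piSplitAt n fun ν => Fin (Kdim ν)).symm (b, j) n = b := by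
  simp [Equiv.piSplitAt]

theorem piSplitAt_symm_of_ne (n : Fin N) (b : Fin (Kdim n))
    (j : ∀ ν : {ν // ν ≠ n}, Fin (Kdim ν)) (ν : {ν // ν ≠ n}) :
    (Equiv.piSplitAt n fun ν => Fin (Kdim ν)).symm (b, j) ν = j ν := by
  simp [Equiv.piSplitAt, ν.2]

theorem core_piSplitAt_symm (X : (∀ n, Fin (Idim n)) → ℝ) (n : Fin N)
    (U : ∀ m, Matrix (Fin (Idim m)) (Fin (Kdim m)) ℝ) (b : Fin (Kdim n))
    (j : ∀ ν : {ν // ν ≠ n}, Fin (Kdim ν)) :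
    core X U ((Equiv.piSplitAt n fun ν => Fin (Kdim ν)).symm (b, j)) =
      ((U n)ᵀ * partialUnfolding X n U) b j := by
  rw [core_eq_transpose_mul_partialUnfolding X n, piSplitAt_symm_self]
  simp only [piSplitAt_symm_of_ne]

theorem obj_eq_trace (X : (∀ n, Fin (Idim n)) → ℝ) (n : Fin N)
    (U : ∀ m, Matrix (Fin (Idim m)) (Fin (Kdim m)) ℝ) :
    obj X U = (((U n)ᵀ * partialUnfolding X n U)ᵀ *
      ((U n)ᵀ * partialUnfolding X n U)).trace := by
  rw [trace_transpose_mul_self_eq_sum_sq, obj, sum_pi_eq_sum_sum_piSplitAt n]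
  simp only [core_piSplitAt_symm]

theorem ttmctc_eq_mul_transpose (X : (∀ n, Fin (Idim n)) → ℝ) (n : Fin N)
    (U : ∀ m, Matrix (Fin (Idim m)) (Fin (Kdim m)) ℝ) :
    ttmctc X n U = partialUnfolding X n U * ((U n)ᵀ * partialUnfolding X n U)ᵀ := by
  ext a b
  rw [mul_apply]
  simp only [ttmctc, of_apply, sum_pi_eq_sum_sum_piSplitAt (Kdim := Kdim) n,
    core_piSplitAt_symm, prod_erase_eq_prod_subtype_ne, piSplitAt_symm_of_ne,
    piSplitAt_symm_self, transpose_apply]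
  generalize (U n)ᵀ * partialUnfolding X n U = G
  simp only [partialUnfolding, of_apply, Finset.sum_mul]
  rw [Finset.sum_comm (s := Finset.univ (α := ∀ ν : {ν // ν ≠ n}, Fin (Kdim ν)))]
  refine Finset.sum_congr rfl fun i _ => ?_
  rw [Finset.sum_eq_single b (fun c _ hc => by simp [hc]) (by simp)]
  refine Finset.sum_congr rfl fun j _ => ?_
  by_cases h : i n = a
  · simp only [h, and_self, if_true]; ring
  · simp [h]

theorem gramCore_eq_mul_transpose (X : (∀ n, Fin (Idim n)) → ℝ) (n : Fin N)
    (U : ∀ m, Matrix (Fin (Idim m)) (Fin (Kdim m)) ℝ) :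
    gramCore X n U = ((U n)ᵀ * partialUnfolding X n U) *
      ((U n)ᵀ * partialUnfolding X n U)ᵀ := by
  have hupdate : ∀ (b c : Fin (Kdim n)) (j : ∀ ν : {ν // ν ≠ n}, Fin (Kdim ν)),
      core X U (Function.update
        ((Equiv.piSplitAt n fun ν => Fin (Kdim ν)).symm (c, j)) n b) =
      ((U n)ᵀ * partialUnfolding X n U) b j := fun b c j => by
    rw [core_eq_transpose_mul_partialUnfolding X n, Function.update_self]
    refine congrArg _ (funext fun ν => ?_)
    rw [Function.update_of_ne ν.2, piSplitAt_symm_of_ne]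
  ext a b
  rw [mul_apply]
  simp only [gramCore, of_apply, sum_pi_eq_sum_sum_piSplitAt (Kdim := Kdim) n, hupdate,
    core_piSplitAt_symm, piSplitAt_symm_self, transpose_apply]
  rw [Finset.sum_eq_single a (fun c _ hc => by simp [hc]) (by simp)]
  simp

end Unfolding

theorem IsHOQRI.transpose_mul_self {N : ℕ} {hN : 0 < N} {Idim Kdim : Fin N → ℕ}
    {X : (∀ n, Fin (Idim n)) → ℝ}
    {U : ℕ → ∀ n, Matrix (Fin (Idim n)) (Fin (Kdim n)) ℝ}
    (hU : IsHOQRI hN X U) (t : ℕ) (m : Fin N) : (U t m)ᵀ * U t m = 1 := by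
  induction t with
  | zero => exact hU.1 m
  | succ t ih =>
    obtain ⟨hV, -, -, hrest⟩ := hU.2 t
    by_cases hm : m = blockAt hN t
    · subst hm; exact hV
    · rw [hrest m hm]; exact ih

/-- Per-iteration gradient bound for HOQRI (tensor form). If `f_sup` upper bounds the
objective over all tuples of factor matrices with orthonormal columns, then for every
step `t`, with `n = n_t` the updated block,
`‖2A_t⁽ⁿ⁾ − 2U_t⁽ⁿ⁾M_t⁽ⁿ⁾‖_F² ≤ 4 f_sup (f({U_{t+1}}) − f({U_t}))`. -/
theorem hoqri_per_iteration_gradient_bound {N : ℕ} (hN : 0 < N)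
    {Idim Kdim : Fin N → ℕ} (X : (∀ n, Fin (Idim n)) → ℝ)
    (U : ℕ → ∀ n, Matrix (Fin (Idim n)) (Fin (Kdim n)) ℝ)
    (hU : IsHOQRI hN X U)
    (fsup : ℝ)
    (hsup : ∀ V : ∀ n, Matrix (Fin (Idim n)) (Fin (Kdim n)) ℝ,
      (∀ n, (V n)ᵀ * V n = 1) → obj X V ≤ fsup) :
    ∀ t : ℕ,
      frobSq ((2 : ℝ) • ttmctc X (blockAt hN t) (U t) -
          (2 : ℝ) • (U t (blockAt hN t) * gramCore X (blockAt hN t) (U t))) ≤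
        4 * fsup * (obj X (U (t + 1)) - obj X (U t)) := by
  intro t
  obtain ⟨hV, -, hrange, hrest⟩ := hU.2 t
  set n := blockAt hN t
  have hle := hsup (U t) (hU.transpose_mul_self t)
  rw [obj_eq_trace X n] at hle
  rw [ttmctc_eq_mul_transpose] at hrange
  have key := trace_gradient_le_mul_sub (partialUnfolding X n (U t)) (U t n) (U (t + 1) n)
    (hU.transpose_mul_self t n) hV hrange.ge hle
  rw [obj_eq_trace X n (U t), obj_eq_trace X n (U (t + 1)), partialUnfolding_congr X n hrest,
    ttmctc_eq_mul_transpose, gramCore_eq_mul_transpose, ← smul_sub, frobSq, transpose_smul,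
    Matrix.smul_mul, Matrix.mul_smul, trace_smul, trace_smul, smul_eq_mul, smul_eq_mul]
  linarith
end
end

section
/- Theorem 2 (convergence of HOQRI to the set of stationary points). Let X be an N-way tensor and let {U_t}_{t≥0} be HOQRI iterates, where at each step the TTMcTC matrix of the updated block is assumed to have full column rank. Let 𝒰* be the set of all tuples {V} of factor matrices with orthonormal columns such that 2A^{(n)} − 2V^{(n)}M^{(n)} = 0 for every n = 1,…,N (all partial Riemannian gradients vanish), where A^{(n)} and M^{(n)} are computed at {V}. Then lim_{t→∞} d({U_t}, 𝒰*) = 0, where d({U}, 𝒰*) := inf_{{V}∈𝒰*} ∑_{n=1}^N min_{Q∈O(K_n)} ‖U^{(n)} − V^{(n)}Q‖_F². In particular, every limit point of {U_t} is a stationary point. -/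
open Matrix Finset

noncomputable section

/-- The Procrustes subspace distance `d(U,V) = min_{Q ∈ O(K)} ‖U − V Q‖_F²`
(expressed as an infimum over the orthogonal group). -/
def procSq {I K : ℕ} (U V : Matrix (Fin I) (Fin K) ℝ) : ℝ :=
  sInf {x : ℝ | ∃ Q : Matrix (Fin K) (Fin K) ℝ, Qᵀ * Q = 1 ∧ Q * Qᵀ = 1 ∧
    x = frobSq (U - V * Q)}

/-- The set `𝒰*` of stationary points: tuples of factor matrices with orthonormal
columns at which all partial Riemannian gradients `2A⁽ⁿ⁾ − 2V⁽ⁿ⁾M⁽ⁿ⁾` vanish. -/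
def stationarySet {N : ℕ} {Idim Kdim : Fin N → ℕ} (X : (∀ n, Fin (Idim n)) → ℝ) :
    Set (∀ n, Matrix (Fin (Idim n)) (Fin (Kdim n)) ℝ) :=
  {V | (∀ n, (V n)ᵀ * V n = 1) ∧
    ∀ n, (2 : ℝ) • ttmctc X n V - (2 : ℝ) • (V n * gramCore X n V) = 0}

/-- The Kronecker-type product of a family of matrices, indexed by multi-indices. -/
def tensorMat {N : ℕ} {I J : Fin N → ℕ} (U : ∀ n, Matrix (Fin (I n)) (Fin (J n)) ℝ) :
    Matrix (∀ n, Fin (I n)) (∀ n, Fin (J n)) ℝ :=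
  Matrix.of fun i j => ∏ n, U n (i n) (j n)

/-- The tensor `X` projected onto the column space of `U⁽ⁿ⁾` in every mode `n`. -/
def projTensor {N : ℕ} {I J : Fin N → ℕ} (X : (∀ n, Fin (I n)) → ℝ)
    (U : ∀ n, Matrix (Fin (I n)) (Fin (J n)) ℝ) : (∀ n, Fin (I n)) → ℝ :=
  tensorMat (fun n => U n * (U n)ᵀ) *ᵥ X

/-- Contraction of two tensors over all modes except `n`. -/
def contractExcept {N : ℕ} {I : Fin N → ℕ} (n : Fin N) (X Z : (∀ n, Fin (I n)) → ℝ) :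
    Matrix (Fin (I n)) (Fin (I n)) ℝ :=
  Matrix.of fun a b => ∑ i, if i n = a then X i * Z (Function.update i n b) else 0

/-- The component of the mode-`n` contraction of `X` with its projection that is normal to the
column space of `U⁽ⁿ⁾`; it carries the same information as the mode-`n` gradient. -/
def normalPart {N : ℕ} {I J : Fin N → ℕ} (X : (∀ n, Fin (I n)) → ℝ) (n : Fin N)
    (U : ∀ n, Matrix (Fin (I n)) (Fin (J n)) ℝ) : Matrix (Fin (I n)) (Fin (I n)) ℝ :=
  (1 - U n * (U n)ᵀ) * contractExcept n X (projTensor X U)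

section TensorAlgebra

variable {N : ℕ} {I J K : Fin N → ℕ}

theorem tensorMat_mul (A : ∀ n, Matrix (Fin (I n)) (Fin (J n)) ℝ)
    (B : ∀ n, Matrix (Fin (J n)) (Fin (K n)) ℝ) :
    tensorMat A * tensorMat B = tensorMat fun n => A n * B n := by
  ext i k
  simp only [tensorMat, Matrix.mul_apply, Matrix.of_apply, Fintype.prod_sum,
    Finset.prod_mul_distrib]

theorem tensorMat_transpose (A : ∀ n, Matrix (Fin (I n)) (Fin (J n)) ℝ) :
    (tensorMat A)ᵀ = tensorMat fun n => (A n)ᵀ := rfl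

theorem prod_update_left (A : ∀ n, Matrix (Fin (I n)) (Fin (J n)) ℝ) (n : Fin N)
    (i : ∀ n, Fin (I n)) (j : ∀ n, Fin (J n)) (c : Fin (I n)) :
    ∏ m, A m (Function.update i n c m) (j m) =
      A n c (j n) * ∏ m ∈ univ.erase n, A m (i m) (j m) := by
  rw [← Finset.mul_prod_erase univ _ (Finset.mem_univ n), Function.update_self]
  congr 1
  refine Finset.prod_congr rfl fun m hm => ?_
  rw [Function.update_of_ne (Finset.ne_of_mem_erase hm)]

theorem prod_update_right (A : ∀ n, Matrix (Fin (I n)) (Fin (J n)) ℝ) (n : Fin N)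
    (i : ∀ n, Fin (I n)) (j : ∀ n, Fin (J n)) (c : Fin (J n)) :
    ∏ m, A m (i m) (Function.update j n c m) =
      A n (i n) c * ∏ m ∈ univ.erase n, A m (i m) (j m) :=
  prod_update_left (fun m => (A m)ᵀ) n j i c

theorem projTensor_apply_core (X : (∀ n, Fin (I n)) → ℝ)
    (U : ∀ n, Matrix (Fin (I n)) (Fin (J n)) ℝ) (i : ∀ n, Fin (I n)) :
    projTensor X U i = ∑ k, (∏ n, U n (i n) (k n)) * core X U k := by
  have h : core X U = (tensorMat U)ᵀ *ᵥ X := by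
    ext k
    simp [core, tensorMat, Matrix.mulVec, dotProduct, mul_comm]
  have h2 : projTensor X U = tensorMat U *ᵥ core X U := by
    rw [h, Matrix.mulVec_mulVec, tensorMat_transpose, tensorMat_mul]
    rfl
  rw [h2]
  rfl

theorem contractExcept_projTensor (X : (∀ n, Fin (I n)) → ℝ) (n : Fin N)
    (U : ∀ n, Matrix (Fin (I n)) (Fin (J n)) ℝ) :
    contractExcept n X (projTensor X U) = ttmctc X n U * (U n)ᵀ := by
  ext a c
  simp only [contractExcept, ttmctc, Matrix.of_apply, Matrix.mul_apply, Matrix.transpose_apply,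
    Finset.sum_mul]
  rw [Finset.sum_comm]
  refine Finset.sum_congr rfl fun i _ => ?_
  rw [Finset.sum_comm]
  split_ifs with h
  · rw [projTensor_apply_core, Finset.mul_sum]
    refine Finset.sum_congr rfl fun k _ => ?_
    rw [Finset.sum_eq_single (k n), if_pos ⟨h, rfl⟩, prod_update_left]
    · ring
    · intro b _ hb
      rw [if_neg fun hh => hb hh.2.symm, zero_mul]
    · simp
  · refine (Finset.sum_eq_zero fun k _ => Finset.sum_eq_zero fun b _ => ?_).symm
    rw [if_neg fun hh => h hh.1, zero_mul]

theorem sum_ite_update_comm (G : (∀ n, Fin (J n)) → ℝ) (n : Fin N) (a b : Fin (J n)) :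
    (∑ k, if k n = a then G k * G (Function.update k n b) else 0) =
      ∑ k, if k n = b then G k * G (Function.update k n a) else 0 := by
  rw [← Finset.sum_filter, ← Finset.sum_filter]
  refine Finset.sum_bij' (fun k _ => Function.update k n b) (fun k _ => Function.update k n a)
    ?_ ?_ ?_ ?_ ?_
  · intro k _; simp
  · intro k _; simp
  · intro k hk
    simp only [Finset.mem_filter, Finset.mem_univ, true_and] at hk
    simp [← hk]
  · intro k hk
    simp only [Finset.mem_filter, Finset.mem_univ, true_and] at hk
    simp [← hk]
  · intro k hk
    simp only [Finset.mem_filter, Finset.mem_univ, true_and] at hk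
    simp [← hk, mul_comm]

theorem gramCore_eq (X : (∀ n, Fin (I n)) → ℝ) (n : Fin N)
    (U : ∀ n, Matrix (Fin (I n)) (Fin (J n)) ℝ) :
    gramCore X n U = (U n)ᵀ * ttmctc X n U := by
  ext a b
  simp only [gramCore, Matrix.of_apply]
  rw [sum_ite_update_comm]
  simp only [ttmctc, Matrix.of_apply, Matrix.mul_apply, Matrix.transpose_apply, Finset.mul_sum]
  rw [Finset.sum_comm, Finset.sum_congr rfl fun i _ => Finset.sum_comm, Finset.sum_comm]
  refine Finset.sum_congr rfl fun k _ => ?_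
  split_ifs with h
  · rw [show core X U (Function.update k n a) =
      ∑ i, X i * ∏ m, U m (i m) (Function.update k n a m) from rfl, Finset.mul_sum]
    refine Finset.sum_congr rfl fun i _ => ?_
    rw [Finset.sum_eq_single (i n), if_pos ⟨rfl, h⟩, prod_update_right]
    · ring
    · intro c _ hc
      rw [if_neg fun hh => hc hh.1.symm, mul_zero]
    · simp
  · refine (Finset.sum_eq_zero fun i _ => Finset.sum_eq_zero fun c _ => ?_).symm
    rw [if_neg fun hh => h hh.2, mul_zero]

/-- The mode-`n` partial gradient vanishes as soon as the normal part does. -/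
theorem ttmctc_sub_eq_normalPart_mul (X : (∀ n, Fin (I n)) → ℝ) (n : Fin N)
    (U : ∀ n, Matrix (Fin (I n)) (Fin (J n)) ℝ) (hU : (U n)ᵀ * U n = 1) :
    ttmctc X n U - U n * gramCore X n U = normalPart X n U * U n := by
  rw [normalPart, contractExcept_projTensor, gramCore_eq, Matrix.mul_assoc, Matrix.mul_assoc, hU,
    Matrix.mul_one, Matrix.sub_mul, Matrix.one_mul, Matrix.mul_assoc]

theorem trace_contractExcept (X Z : (∀ n, Fin (I n)) → ℝ) (n : Fin N) :
    (contractExcept n X Z).trace = X ⬝ᵥ Z := by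
  simp only [Matrix.trace, Matrix.diag, contractExcept, Matrix.of_apply, dotProduct]
  rw [Finset.sum_comm]
  refine Finset.sum_congr rfl fun i _ => ?_
  simp

theorem trace_mul_contractExcept (X : (∀ n, Fin (I n)) → ℝ) (n : Fin N)
    (P P' : ∀ n, Matrix (Fin (I n)) (Fin (I n)) ℝ) (hP' : (P' n)ᵀ = P' n)
    (hne : ∀ m, m ≠ n → P' m * P m = P m) :
    (P' n * contractExcept n X (tensorMat P *ᵥ X)).trace =
      X ⬝ᵥ (tensorMat P' *ᵥ (tensorMat P *ᵥ X)) := by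
  rw [Matrix.mulVec_mulVec, tensorMat_mul]
  have key : ∀ i, ((tensorMat fun m => P' m * P m) *ᵥ X) i =
      ∑ c, P' n (i n) c * (tensorMat P *ᵥ X) (Function.update i n c) := by
    intro i
    simp only [Matrix.mulVec, dotProduct, tensorMat, Matrix.of_apply, Finset.mul_sum]
    rw [Finset.sum_comm]
    refine Finset.sum_congr rfl fun j _ => ?_
    simp only [prod_update_left]
    rw [← Finset.mul_prod_erase univ _ (Finset.mem_univ n), Matrix.mul_apply, Finset.sum_mul,
      Finset.sum_mul]
    refine Finset.sum_congr rfl fun c _ => ?_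
    rw [Finset.prod_congr rfl fun m hm => by rw [hne m (Finset.ne_of_mem_erase hm)]]
    ring
  simp only [Matrix.trace, Matrix.diag, Matrix.mul_apply, contractExcept, Matrix.of_apply,
    dotProduct, key, Finset.mul_sum]
  rw [Finset.sum_congr rfl fun a _ => Finset.sum_comm, Finset.sum_comm]
  refine Finset.sum_congr rfl fun i _ => ?_
  simp only [mul_ite, mul_zero, Finset.sum_ite_eq, Finset.mem_univ, if_true]
  refine Finset.sum_congr rfl fun c _ => ?_
  rw [← congrFun₂ hP' (i n) c, Matrix.transpose_apply]
  ring

theorem proj_mul_proj {m k : ℕ} {A : Matrix (Fin m) (Fin k) ℝ} (hA : Aᵀ * A = 1) :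
    A * Aᵀ * (A * Aᵀ) = A * Aᵀ := by
  rw [Matrix.mul_assoc, ← Matrix.mul_assoc Aᵀ, hA, Matrix.one_mul]

theorem proj_transpose {m k : ℕ} (A : Matrix (Fin m) (Fin k) ℝ) : (A * Aᵀ)ᵀ = A * Aᵀ := by
  rw [Matrix.transpose_mul, Matrix.transpose_transpose]

theorem projTensor_dotProduct (X : (∀ n, Fin (I n)) → ℝ)
    (U V : ∀ n, Matrix (Fin (I n)) (Fin (J n)) ℝ) :
    projTensor X V ⬝ᵥ projTensor X U =
      X ⬝ᵥ (tensorMat (fun n => V n * (V n)ᵀ) *ᵥ projTensor X U) := by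
  rw [Matrix.dotProduct_mulVec, ← Matrix.mulVec_transpose, tensorMat_transpose]
  simp only [proj_transpose]
  rfl

theorem projTensor_dotProduct_self (X : (∀ n, Fin (I n)) → ℝ)
    (U : ∀ n, Matrix (Fin (I n)) (Fin (J n)) ℝ) (hU : ∀ n, (U n)ᵀ * U n = 1) :
    projTensor X U ⬝ᵥ projTensor X U = X ⬝ᵥ projTensor X U := by
  rw [projTensor_dotProduct, projTensor, Matrix.mulVec_mulVec, tensorMat_mul]
  simp only [proj_mul_proj (hU _)]

theorem projTensor_norm_sub_sq (X : (∀ n, Fin (I n)) → ℝ) (n : Fin N)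
    (U V : ∀ n, Matrix (Fin (I n)) (Fin (J n)) ℝ) (hU : ∀ n, (U n)ᵀ * U n = 1)
    (hV : ∀ n, (V n)ᵀ * V n = 1) (hne : ∀ m, m ≠ n → V m = U m)
    (hfix : V n * (V n)ᵀ * contractExcept n X (projTensor X U) =
      contractExcept n X (projTensor X U)) :
    (projTensor X V - projTensor X U) ⬝ᵥ (projTensor X V - projTensor X U) =
      X ⬝ᵥ projTensor X V - X ⬝ᵥ projTensor X U := by
  have hcross : projTensor X V ⬝ᵥ projTensor X U = X ⬝ᵥ projTensor X U := by
    rw [projTensor_dotProduct, ← trace_contractExcept X (projTensor X U) n, ← hfix]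
    refine (trace_mul_contractExcept X n (fun n => U n * (U n)ᵀ) (fun n => V n * (V n)ᵀ)
      (proj_transpose _) fun m hm => ?_).symm
    simp only [hne m hm, proj_mul_proj (hU m)]
  rw [sub_dotProduct, dotProduct_sub, dotProduct_sub, projTensor_dotProduct_self X U hU,
    projTensor_dotProduct_self X V hV, dotProduct_comm (projTensor X U), hcross]
  ring

theorem dotProduct_projTensor_le (X : (∀ n, Fin (I n)) → ℝ)
    (U : ∀ n, Matrix (Fin (I n)) (Fin (J n)) ℝ) (hU : ∀ n, (U n)ᵀ * U n = 1) :
    X ⬝ᵥ projTensor X U ≤ X ⬝ᵥ X := by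
  have h : 0 ≤ (X - projTensor X U) ⬝ᵥ (X - projTensor X U) :=
    Finset.sum_nonneg fun i _ => mul_self_nonneg _
  rw [sub_dotProduct, dotProduct_sub, dotProduct_sub, projTensor_dotProduct_self X U hU,
    dotProduct_comm (projTensor X U)] at h
  linarith

end TensorAlgebra

theorem proj_mul_of_range_le {m k l : ℕ} {A : Matrix (Fin m) (Fin k) ℝ}
    {B : Matrix (Fin m) (Fin l) ℝ} (hA : Aᵀ * A = 1)
    (h : LinearMap.range B.mulVecLin ≤ LinearMap.range A.mulVecLin) : A * Aᵀ * B = B := by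
  refine Matrix.toLin'.injective (LinearMap.ext fun v => ?_)
  obtain ⟨w, hw⟩ := h ⟨v, rfl⟩
  simp only [Matrix.mulVecLin_apply] at hw
  simp only [Matrix.toLin'_apply]
  rw [← Matrix.mulVec_mulVec, ← hw, Matrix.mulVec_mulVec, Matrix.mul_assoc, hA, Matrix.mul_one]

theorem abs_entry_le_one {m k : ℕ} {A : Matrix (Fin m) (Fin k) ℝ} (hA : Aᵀ * A = 1)
    (i : Fin m) (j : Fin k) : |A i j| ≤ 1 := by
  have h : ∑ a, A a j * A a j = 1 := by
    simpa [Matrix.mul_apply] using congrFun₂ hA j j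
  have h2 := Finset.single_le_sum (f := fun a => A a j * A a j)
    (fun a _ => mul_self_nonneg _) (Finset.mem_univ i)
  rw [← sq_le_one_iff_abs_le_one]
  nlinarith

theorem abs_one_sub_proj_le {m k : ℕ} {A : Matrix (Fin m) (Fin k) ℝ} (hA : Aᵀ * A = 1)
    (i j : Fin m) : |(1 - A * Aᵀ : Matrix (Fin m) (Fin m) ℝ) i j| ≤ 1 + k := by
  rw [Matrix.sub_apply]
  refine (abs_sub _ _).trans (add_le_add ?_ ?_)
  · rw [Matrix.one_apply]
    split_ifs <;> simp
  · rw [Matrix.mul_apply]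
    refine (Finset.abs_sum_le_sum_abs _ _).trans ?_
    calc _ ≤ ∑ _c : Fin k, (1 : ℝ) := Finset.sum_le_sum fun c _ => by
          rw [abs_mul, Matrix.transpose_apply]
          exact mul_le_one₀ (abs_entry_le_one hA _ _) (abs_nonneg _) (abs_entry_le_one hA _ _)
      _ = k := by simp

/-- A sequence with vanishing increments that is reset to a vanishing value at least once in
every window of fixed length tends to zero. -/
theorem tendsto_zero_of_periodic_reset {e δ : ℕ → ℝ} {p : ℕ → Prop} (N : ℕ)
    (hδ : Filter.Tendsto δ Filter.atTop (nhds 0)) (hp : ∀ t, ∃ s < N, p (t + s))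
    (hreset : ∀ t, p t → e (t + 1) = δ t) (hstep : ∀ t, ¬ p t → e (t + 1) = δ t + e t) :
    Filter.Tendsto e Filter.atTop (nhds 0) := by
  have key : ∀ t j, (∃ s < j, p (t + s)) → |e (t + j)| ≤ ∑ s ∈ range j, |δ (t + s)| := by
    intro t j
    induction j with
    | zero => rintro ⟨s, hs, -⟩; omega
    | succ j ih =>
      rintro ⟨s, hs, hps⟩
      rw [Finset.sum_range_succ, ← add_assoc]
      by_cases hj : p (t + j)
      · rw [hreset _ hj]
        exact le_add_of_nonneg_left (Finset.sum_nonneg fun _ _ => abs_nonneg _)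
      · have hsj : s < j := by
          rcases Nat.lt_succ_iff_lt_or_eq.mp hs with h | rfl
          · exact h
          · exact absurd hps hj
        rw [hstep _ hj]
        linarith [abs_add_le (δ (t + j)) (e (t + j)), ih ⟨s, hsj, hps⟩]
  rw [← Filter.tendsto_add_atTop_iff_nat N]
  refine squeeze_zero_norm (fun t => key t N (hp t)) ?_
  have : Filter.Tendsto (fun t => ∑ s ∈ range N, |δ (t + s)|) Filter.atTop
      (nhds (∑ s ∈ range N, |(0 : ℝ)|)) :=
    tendsto_finsetSum _ fun s _ => ((Filter.tendsto_add_atTop_iff_nat s).mpr hδ).abs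
  simpa using this

theorem blockAt_window {N : ℕ} (hN : 0 < N) (m : Fin N) (t : ℕ) :
    ∃ s < N, m = blockAt hN (t + s) := by
  refine ⟨(m + (N - t % N)) % N, Nat.mod_lt _ hN, Fin.ext ?_⟩
  have h1 := Nat.mod_lt t hN
  have h2 : (t + (m + (N - t % N))) = m + N * (t / N + 1) := by
    have := Nat.div_add_mod t N
    rw [Nat.mul_add, Nat.mul_one]
    omega
  simp only [blockAt]
  rw [Nat.add_mod_mod, h2, Nat.add_mul_mod_self_left, Nat.mod_eq_of_lt m.2]

section Iterates

variable {N : ℕ} {hN : 0 < N} {I J : Fin N → ℕ} {X : (∀ n, Fin (I n)) → ℝ}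
  {U : ℕ → ∀ n, Matrix (Fin (I n)) (Fin (J n)) ℝ}

theorem IsHOQRI.orthonormal (hU : IsHOQRI hN X U) (t : ℕ) (n : Fin N) :
    (U t n)ᵀ * U t n = 1 := by
  induction t generalizing n with
  | zero => exact hU.1 n
  | succ t ih =>
    by_cases h : n = blockAt hN t
    · rw [h]
      exact (hU.2 t).1
    · rw [(hU.2 t).2.2.2 n h]
      exact ih n

theorem IsHOQRI.proj_mul_contractExcept (hU : IsHOQRI hN X U) (t : ℕ) :
    U (t + 1) (blockAt hN t) * (U (t + 1) (blockAt hN t))ᵀ *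
        contractExcept (blockAt hN t) X (projTensor X (U t)) =
      contractExcept (blockAt hN t) X (projTensor X (U t)) := by
  rw [contractExcept_projTensor, ← Matrix.mul_assoc,
    proj_mul_of_range_le (hU.2 t).1 (hU.2 t).2.2.1.ge]

theorem IsHOQRI.tendsto_projTensor_sub (hU : IsHOQRI hN X U) (i : ∀ n, Fin (I n)) :
    Filter.Tendsto (fun t => projTensor X (U (t + 1)) i - projTensor X (U t) i)
      Filter.atTop (nhds 0) := by
  set f : ℕ → ℝ := fun t => X ⬝ᵥ projTensor X (U t) with hf
  have hstep : ∀ t, (projTensor X (U (t + 1)) - projTensor X (U t)) ⬝ᵥ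
      (projTensor X (U (t + 1)) - projTensor X (U t)) = f (t + 1) - f t := fun t =>
    projTensor_norm_sub_sq X (blockAt hN t) (U t) (U (t + 1)) (hU.orthonormal t)
      (hU.orthonormal (t + 1)) (hU.2 t).2.2.2 (hU.proj_mul_contractExcept t)
  have hsq : ∀ t, (projTensor X (U (t + 1)) i - projTensor X (U t) i) ^ 2 ≤
      f (t + 1) - f t := by
    intro t
    rw [← hstep, sq]
    exact Finset.single_le_sum (f := fun i => (projTensor X (U (t + 1)) - projTensor X (U t)) i *
      (projTensor X (U (t + 1)) - projTensor X (U t)) i) (fun a _ => mul_self_nonneg _)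
      (Finset.mem_univ i)
  have hmono : Monotone f := monotone_nat_of_le_succ fun t => by
    linarith [hsq t, sq_nonneg (projTensor X (U (t + 1)) i - projTensor X (U t) i)]
  have hbdd : BddAbove (Set.range f) := ⟨X ⬝ᵥ X, by
    rintro _ ⟨t, rfl⟩
    exact dotProduct_projTensor_le X (U t) (hU.orthonormal t)⟩
  have hlim := tendsto_atTop_ciSup hmono hbdd
  have hdiff := ((Filter.tendsto_add_atTop_iff_nat 1).mpr hlim).sub hlim
  rw [sub_self] at hdiff
  have h := (squeeze_zero (fun t => sq_nonneg _) hsq hdiff).sqrt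
  simp only [Real.sqrt_sq_eq_abs, Real.sqrt_zero] at h
  exact (tendsto_zero_iff_abs_tendsto_zero _).mpr h

theorem IsHOQRI.tendsto_normalPart (hU : IsHOQRI hN X U) (m : Fin N) (a b : Fin (I m)) :
    Filter.Tendsto (fun t => normalPart X m (U t) a b) Filter.atTop (nhds 0) := by
  set H : ℕ → Matrix (Fin (I m)) (Fin (I m)) ℝ := fun t =>
    contractExcept m X (projTensor X (U t)) with hH
  have hΔ : ∀ c, Filter.Tendsto (fun t => (H (t + 1) - H t) c b) Filter.atTop (nhds 0) := by
    intro c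
    have h : ∀ t, (H (t + 1) - H t) c b = ∑ i, (if i m = c then X i else 0) *
        (projTensor X (U (t + 1)) (Function.update i m b) -
          projTensor X (U t) (Function.update i m b)) := by
      intro t
      simp only [hH, Matrix.sub_apply, contractExcept, Matrix.of_apply, ← Finset.sum_sub_distrib]
      refine Finset.sum_congr rfl fun i _ => ?_
      split_ifs <;> ring
    simp only [h]
    rw [← Finset.sum_const_zero (s := (univ : Finset (∀ n, Fin (I n))))]
    refine tendsto_finsetSum _ fun i _ => ?_
    simpa using (hU.tendsto_projTensor_sub (Function.update i m b)).const_mul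
      (if i m = c then X i else 0)
  refine tendsto_zero_of_periodic_reset N
    (δ := fun t => ((1 - U (t + 1) m * (U (t + 1) m)ᵀ) * (H (t + 1) - H t) :
      Matrix (Fin (I m)) (Fin (I m)) ℝ) a b)
    (p := fun t => m = blockAt hN t) ?_ (blockAt_window hN m) ?_ ?_
  · change Filter.Tendsto (fun t => ∑ c, (1 - U (t + 1) m * (U (t + 1) m)ᵀ :
      Matrix (Fin (I m)) (Fin (I m)) ℝ) a c * (H (t + 1) - H t) c b) Filter.atTop (nhds 0)
    rw [← Finset.sum_const_zero (s := (univ : Finset (Fin (I m))))]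
    refine tendsto_finsetSum _ fun c _ => ?_
    refine squeeze_zero_norm (a := fun t => (1 + J m) * |(H (t + 1) - H t) c b|) (fun t => ?_) ?_
    · rw [Real.norm_eq_abs, abs_mul]
      exact mul_le_mul_of_nonneg_right (abs_one_sub_proj_le (hU.orthonormal _ _) _ _)
        (abs_nonneg _)
    · simpa using (hΔ c).abs.const_mul (1 + (J m : ℝ))
  · rintro t rfl
    simp only [normalPart]
    rw [Matrix.mul_sub, Matrix.sub_mul _ _ (H t), hU.proj_mul_contractExcept t, Matrix.one_mul,
      sub_self, sub_zero]
  · intro t ht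
    rw [← Matrix.add_apply]
    simp only [normalPart]
    rw [Matrix.mul_sub, (hU.2 t).2.2.2 m ht, sub_add_cancel]

end Iterates

section Compactness

variable {N : ℕ} {I J : Fin N → ℕ}

theorem isCompact_orthonormal :
    IsCompact {V : ∀ n, Matrix (Fin (I n)) (Fin (J n)) ℝ | ∀ n, (V n)ᵀ * V n = 1} := by
  have hK : IsCompact (Set.univ.pi fun n => Set.univ.pi fun _ : Fin (I n) =>
      Set.univ.pi fun _ : Fin (J n) => Set.Icc (-1 : ℝ) 1) :=
    isCompact_univ_pi fun n => isCompact_univ_pi fun _ => isCompact_univ_pi fun _ => isCompact_Icc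
  refine hK.of_isClosed_subset ?_ fun V hV n _ i _ j _ => abs_le.mp (abs_entry_le_one (hV n) i j)
  simp only [Set.ofPred_forall]
  exact isClosed_iInter fun n => isClosed_eq (by fun_prop) continuous_const

theorem continuous_normalPart (X : (∀ n, Fin (I n)) → ℝ) (n : Fin N) (a b : Fin (I n)) :
    Continuous fun V : ∀ n, Matrix (Fin (I n)) (Fin (J n)) ℝ => normalPart X n V a b := by
  have hent : ∀ m (i : Fin (I m)) (j : Fin (J m)),
      Continuous fun V : ∀ n, Matrix (Fin (I n)) (Fin (J n)) ℝ => V m i j := fun m i j => by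
    fun_prop
  simp only [normalPart, contractExcept, projTensor_apply_core, core, Matrix.mul_apply,
    Matrix.sub_apply, Matrix.of_apply, Matrix.transpose_apply, ← Finset.sum_filter]
  fun_prop

theorem frobSq_eq_sum {m k : ℕ} (A : Matrix (Fin m) (Fin k) ℝ) :
    frobSq A = ∑ j, ∑ i, A i j ^ 2 := by
  simp [frobSq, Matrix.trace, Matrix.mul_apply, sq]

theorem frobSq_nonneg {m k : ℕ} (A : Matrix (Fin m) (Fin k) ℝ) : 0 ≤ frobSq A := by
  rw [frobSq_eq_sum]
  positivity

theorem procSq_nonneg {m k : ℕ} (A B : Matrix (Fin m) (Fin k) ℝ) : 0 ≤ procSq A B := by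
  refine Real.sInf_nonneg ?_
  rintro _ ⟨Q, -, -, rfl⟩
  exact frobSq_nonneg _

theorem procSq_le_frobSq {m k : ℕ} (A B : Matrix (Fin m) (Fin k) ℝ) :
    procSq A B ≤ frobSq (A - B) := by
  refine csInf_le ⟨0, ?_⟩ ⟨1, by simp, by simp, by simp⟩
  rintro _ ⟨Q, -, -, rfl⟩
  exact frobSq_nonneg _

theorem continuous_frobSq {m k : ℕ} : Continuous (frobSq : Matrix (Fin m) (Fin k) ℝ → ℝ) := by
  unfold frobSq
  fun_prop

end Compactness

/-- Theorem 2 (convergence of HOQRI to the set of stationary points):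
`d({U_t}, 𝒰*) → 0` as `t → ∞`, where
`d({U}, 𝒰*) = inf_{{V} ∈ 𝒰*} ∑_n min_{Q ∈ O(K_n)} ‖U⁽ⁿ⁾ − V⁽ⁿ⁾Q‖_F²`. -/
theorem hoqri_converges_to_stationary_set {N : ℕ} (hN : 0 < N)
    {Idim Kdim : Fin N → ℕ} (X : (∀ n, Fin (Idim n)) → ℝ)
    (U : ℕ → ∀ n, Matrix (Fin (Idim n)) (Fin (Kdim n)) ℝ)
    (hU : IsHOQRI hN X U) :
    Filter.Tendsto
      (fun t : ℕ => sInf {x : ℝ |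
        ∃ V ∈ stationarySet (Idim := Idim) (Kdim := Kdim) X,
          x = ∑ n : Fin N, procSq (U t n) (V n)})
      Filter.atTop (nhds 0) := by
  have hnonneg : ∀ t, 0 ≤ sInf {x : ℝ | ∃ V ∈ stationarySet (Idim := Idim) (Kdim := Kdim) X,
      x = ∑ n : Fin N, procSq (U t n) (V n)} := by
    refine fun t => Real.sInf_nonneg ?_
    rintro _ ⟨V, -, rfl⟩
    exact Finset.sum_nonneg fun n _ => procSq_nonneg _ _
  refine Filter.tendsto_of_subseq_tendsto fun ns hns => ?_
  have hfc (n : Fin N) : FirstCountableTopology (Matrix (Fin (Idim n)) (Fin (Kdim n)) ℝ) :=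
    inferInstanceAs (FirstCountableTopology (Fin (Idim n) → Fin (Kdim n) → ℝ))
  obtain ⟨V, hV, φ, hφ, hlim⟩ := isCompact_orthonormal.tendsto_subseq
    (x := fun k => U (ns k)) fun k => hU.orthonormal (ns k)
  have hsub : Filter.Tendsto (fun k => ns (φ k)) Filter.atTop Filter.atTop :=
    hns.comp hφ.tendsto_atTop
  have hE : ∀ n, normalPart X n V = 0 := by
    intro n
    ext a b
    exact tendsto_nhds_unique (((continuous_normalPart X n a b).tendsto V).comp hlim)
      ((hU.tendsto_normalPart n a b).comp hsub)
  have hVmem : V ∈ stationarySet (Idim := Idim) (Kdim := Kdim) X := by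
    refine ⟨hV, fun n => ?_⟩
    rw [← smul_sub, ttmctc_sub_eq_normalPart_mul X n V (hV n), hE n, Matrix.zero_mul, smul_zero]
  refine ⟨φ, squeeze_zero (fun k => hnonneg _)
    (g := fun k => ∑ n, frobSq (U (ns (φ k)) n - V n)) (fun k => ?_) ?_⟩
  · refine le_trans (csInf_le ⟨0, ?_⟩ ⟨V, hVmem, rfl⟩)
      (Finset.sum_le_sum fun n _ => procSq_le_frobSq _ _)
    rintro _ ⟨W, -, rfl⟩
    exact Finset.sum_nonneg fun n _ => procSq_nonneg _ _
  · have hcont : Continuous fun W : ∀ n, Matrix (Fin (Idim n)) (Fin (Kdim n)) ℝ =>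
        ∑ n, frobSq (W n - V n) :=
      continuous_finsetSum _ fun n _ =>
        continuous_frobSq.comp ((continuous_apply n).sub continuous_const)
    have h := (hcont.tendsto V).comp hlim
    have hzero : ∑ n, frobSq (V n - V n) = 0 := by simp [frobSq]
    rw [hzero] at h
    exact h
end
end
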